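/- arXiv:2404.02433 — 6 statements merged into one kernel-verified Lean document; each statement's English description precedes it below -/
import Mathlib

section
/- There exist positive constants C₁ and C₂ such that the following holds: for all integers Nx, Ny, Nz ≥ 2, all constants 0 < K' ≤ K'', and all face coefficients κ^x_{i−½,j,k}, κ^y_{i,j−½,k}, κ^z_{i,j,k−½} and boundary coefficients κ^in_{i,j}, κ^out_{i,j} all taking values in the interval [K', K''], the symmetric positive definite matrix A associated with the quadratic form a satisfies C₁·(K'/K'')·Nz² ≤ Cond(A) ≤ C₂·(K''/K')·Nz², where Cond(A) = λ_max(A)/λ_min(A). -/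
open Matrix

/-- The set of (real) eigenvalues of a square matrix `M`. -/
noncomputable def eigSet {n : Type*} [Fintype n] [DecidableEq n]
    (M : Matrix n n ℝ) : Set ℝ :=
  {μ : ℝ | ∃ v : n → ℝ, v ≠ 0 ∧ M.mulVec v = μ • v}

/-- The condition number `λ_max / λ_min` of a square matrix with real eigenvalues. -/
noncomputable def condNum {n : Type*} [Fintype n] [DecidableEq n]
    (M : Matrix n n ℝ) : ℝ :=
  sSup (eigSet M) / sInf (eigSet M)

/-- Extend a grid function on `{0,…,Nx−1}×{0,…,Ny−1}×{0,…,Nz−1}` by zero to all of `ℕ³`. -/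
noncomputable def gridExt (Nx Ny Nz : ℕ) (p : Fin Nx × Fin Ny × Fin Nz → ℝ) :
    ℕ → ℕ → ℕ → ℝ := fun i j k =>
  if h : i < Nx ∧ j < Ny ∧ k < Nz then p (⟨i, h.1⟩, ⟨j, h.2.1⟩, ⟨k, h.2.2⟩) else 0

/-- The TPFA quadratic form `a(p,p)` with face coefficients `κx, κy, κz` and
boundary coefficients `κin, κout`. -/
noncomputable def quadForm (Nx Ny Nz : ℕ) (κx κy κz : ℕ → ℕ → ℕ → ℝ)
    (κin κout : ℕ → ℕ → ℝ) (u : ℕ → ℕ → ℕ → ℝ) : ℝ :=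
  (∑ i ∈ Finset.Ico 1 Nx, ∑ j ∈ Finset.range Ny, ∑ k ∈ Finset.range Nz,
    κx i j k * (u i j k - u (i - 1) j k) ^ 2)
  + (∑ i ∈ Finset.range Nx, ∑ j ∈ Finset.Ico 1 Ny, ∑ k ∈ Finset.range Nz,
    κy i j k * (u i j k - u i (j - 1) k) ^ 2)
  + (∑ i ∈ Finset.range Nx, ∑ j ∈ Finset.range Ny, ∑ k ∈ Finset.Ico 1 Nz,
    κz i j k * (u i j k - u i j (k - 1)) ^ 2)
  + (∑ i ∈ Finset.range Nx, ∑ j ∈ Finset.range Ny, 2 * κin i j * (u i j 0) ^ 2)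
  + (∑ i ∈ Finset.range Nx, ∑ j ∈ Finset.range Ny, 2 * κout i j * (u i j (Nz - 1)) ^ 2)

section Rayleigh

variable {n : Type*} [Fintype n] [DecidableEq n] {M : Matrix n n ℝ}

theorem le_of_mem_eigSet {c : ℝ} (h : ∀ p : n → ℝ, c * (p ⬝ᵥ p) ≤ p ⬝ᵥ M.mulVec p)
    {μ : ℝ} (hμ : μ ∈ eigSet M) : c ≤ μ := by
  obtain ⟨v, hv, hMv⟩ := hμ
  have hpos : 0 < v ⬝ᵥ v := by simpa using Matrix.dotProduct_star_self_pos_iff.2 hv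
  have := h v
  rw [hMv, dotProduct_smul, smul_eq_mul] at this
  exact le_of_mul_le_mul_right this hpos

theorem ge_of_mem_eigSet {c : ℝ} (h : ∀ p : n → ℝ, p ⬝ᵥ M.mulVec p ≤ c * (p ⬝ᵥ p))
    {μ : ℝ} (hμ : μ ∈ eigSet M) : μ ≤ c := by
  obtain ⟨v, hv, hMv⟩ := hμ
  have hpos : 0 < v ⬝ᵥ v := by simpa using Matrix.dotProduct_star_self_pos_iff.2 hv
  have := h v
  rw [hMv, dotProduct_smul, smul_eq_mul] at this
  exact le_of_mul_le_mul_right this hpos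

theorem mem_eigSet_eigenvalues (hM : M.IsHermitian) (i : n) : hM.eigenvalues i ∈ eigSet M := by
  refine ⟨hM.eigenvectorBasis i, fun h => ?_, hM.mulVec_eigenvectorBasis i⟩
  refine hM.eigenvectorBasis.orthonormal.ne_zero i ?_
  ext j
  exact congrFun h j

theorem mul_dotProduct_le_of_le_eigSet (hM : M.IsSymm) {c : ℝ} (h : ∀ μ ∈ eigSet M, c ≤ μ)
    (p : n → ℝ) : c * (p ⬝ᵥ p) ≤ p ⬝ᵥ M.mulVec p := by
  have hB : (M - c • (1 : Matrix n n ℝ)).IsHermitian := by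
    rw [Matrix.IsHermitian, Matrix.conjTranspose_eq_transpose_of_trivial]
    simp [hM.eq]
  have hpsd : (M - c • (1 : Matrix n n ℝ)).PosSemidef := by
    refine hB.posSemidef_iff_eigenvalues_nonneg.2 fun i => ?_
    obtain ⟨v, hv, hBv⟩ := mem_eigSet_eigenvalues hB i
    have hmem : hB.eigenvalues i + c ∈ eigSet M := by
      refine ⟨v, hv, ?_⟩
      rw [add_smul, ← hBv]
      simp [Matrix.sub_mulVec, Matrix.smul_mulVec]
    simpa using h _ hmem
  have := hpsd.dotProduct_mulVec_nonneg p
  simp only [star_trivial, Matrix.sub_mulVec, Matrix.smul_mulVec, Matrix.one_mulVec,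
    dotProduct_sub, dotProduct_smul, smul_eq_mul] at this
  linarith

theorem dotProduct_le_mul_of_eigSet_le (hM : M.IsSymm) {c : ℝ} (h : ∀ μ ∈ eigSet M, μ ≤ c)
    (p : n → ℝ) : p ⬝ᵥ M.mulVec p ≤ c * (p ⬝ᵥ p) := by
  have hneg : ∀ μ ∈ eigSet (-M), -c ≤ μ := by
    rintro μ ⟨v, hv, hMv⟩
    rw [Matrix.neg_mulVec] at hMv
    have := h (-μ) ⟨v, hv, by rw [neg_smul, ← hMv, neg_neg]⟩
    linarith
  have := mul_dotProduct_le_of_le_eigSet hM.neg hneg p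
  rw [Matrix.neg_mulVec, dotProduct_neg] at this
  linarith

end Rayleigh

section OneDimensional

open Finset

theorem sum_Ico_one_eq_sum_range (f : ℕ → ℝ) (N : ℕ) :
    ∑ i ∈ Ico 1 N, f i = ∑ i ∈ range (N - 1), f (i + 1) := by
  rw [sum_Ico_eq_sum_range]
  exact sum_congr rfl fun i _ => by rw [add_comm]

theorem sum_Ico_one_le_four_mul_sum {g F : ℕ → ℝ} {c : ℝ} {N : ℕ} (hc : 0 ≤ c)
    (hF : ∀ i, 0 ≤ F i) (hg : ∀ i ∈ Ico 1 N, g i ≤ c * (2 * F i + 2 * F (i - 1))) :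
    ∑ i ∈ Ico 1 N, g i ≤ 4 * c * ∑ i ∈ range N, F i := by
  have hsucc : ∑ i ∈ Ico 1 N, F i ≤ ∑ i ∈ range N, F i :=
    sum_le_sum_of_subset_of_nonneg (fun i hi => by simp at hi ⊢; omega) fun i _ _ => hF i
  have hpred : ∑ i ∈ Ico 1 N, F (i - 1) ≤ ∑ i ∈ range N, F i := by
    rw [sum_Ico_one_eq_sum_range]
    exact sum_le_sum_of_subset_of_nonneg (range_mono (Nat.sub_le N 1)) fun i _ _ => hF i
  calc ∑ i ∈ Ico 1 N, g i ≤ ∑ i ∈ Ico 1 N, c * (2 * F i + 2 * F (i - 1)) := sum_le_sum hg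
    _ = c * (2 * ∑ i ∈ Ico 1 N, F i + 2 * ∑ i ∈ Ico 1 N, F (i - 1)) := by
      rw [← mul_sum, sum_add_distrib, ← mul_sum, ← mul_sum]
    _ ≤ c * (2 * ∑ i ∈ range N, F i + 2 * ∑ i ∈ range N, F i) := by gcongr
    _ = 4 * c * ∑ i ∈ range N, F i := by ring

theorem sq_le_mul_sq_add_sum_sq_sub (f : ℕ → ℝ) (k : ℕ) :
    f k ^ 2 ≤ (k + 1) * (f 0 ^ 2 + ∑ l ∈ range k, (f (l + 1) - f l) ^ 2) := by
  induction k with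
  | zero => simp
  | succ k ih =>
    rw [sum_range_succ]
    set E := f 0 ^ 2 + ∑ l ∈ range k, (f (l + 1) - f l) ^ 2
    have ht : (0 : ℝ) < k + 1 := by positivity
    obtain ⟨d, hd⟩ : ∃ d, f (k + 1) = f k + d := ⟨f (k + 1) - f k, by ring⟩
    have hcross : (k + 1) * (2 * (f k * d)) ≤ f k ^ 2 + ((k + 1) * d) ^ 2 := by
      nlinarith [sq_nonneg (f k - (k + 1) * d)]
    have hcross' : 2 * (f k * d) ≤ E + (k + 1) * d ^ 2 := by
      refine le_of_mul_le_mul_left ?_ ht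
      nlinarith
    rw [hd]
    push_cast
    nlinarith

theorem sum_sq_le_sq_mul_energy (f : ℕ → ℝ) (N : ℕ) :
    ∑ k ∈ range N, f k ^ 2 ≤
      (N : ℝ) ^ 2 * (f 0 ^ 2 + ∑ k ∈ Ico 1 N, (f k - f (k - 1)) ^ 2) := by
  rw [sum_Ico_one_eq_sum_range]
  simp only [Nat.add_sub_cancel]
  set E := f 0 ^ 2 + ∑ l ∈ range (N - 1), (f (l + 1) - f l) ^ 2
  have hE : 0 ≤ E := add_nonneg (sq_nonneg _) (sum_nonneg fun _ _ => sq_nonneg _)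
  have hk : ∀ k ∈ range N, f k ^ 2 ≤ N * E := by
    intro k hk
    have hkN : k + 1 ≤ N := mem_range.1 hk
    have hsub : ∑ l ∈ range k, (f (l + 1) - f l) ^ 2 ≤
        ∑ l ∈ range (N - 1), (f (l + 1) - f l) ^ 2 :=
      sum_le_sum_of_subset_of_nonneg (range_mono (by omega)) fun _ _ _ => sq_nonneg _
    calc f k ^ 2 ≤ (k + 1) * (f 0 ^ 2 + ∑ l ∈ range k, (f (l + 1) - f l) ^ 2) :=
          sq_le_mul_sq_add_sum_sq_sub f k
      _ ≤ N * E := by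
        refine mul_le_mul (by exact_mod_cast hkN) (by simpa [E] using hsub) ?_ (by positivity)
        exact add_nonneg (sq_nonneg _) (sum_nonneg fun _ _ => sq_nonneg _)
  calc ∑ k ∈ range N, f k ^ 2 ≤ ∑ _k ∈ range N, N * E := sum_le_sum hk
    _ = (N : ℝ) ^ 2 * E := by rw [sum_const, card_range, nsmul_eq_mul]; ring

/-- The discrete parabola vanishing at `-1` and `N`. -/
def parabola (N k : ℕ) : ℝ := (k + 1) * (N - k)

theorem pow_five_le_sum_parabola_sq (N : ℕ) :
    (N : ℝ) ^ 5 ≤ 36 * ∑ k ∈ range N, parabola N k ^ 2 := by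
  have hsum : ∀ n : ℕ, ∑ k ∈ range n, parabola N k =
      N * (n * (n + 1)) / 2 - (n - 1) * n * (n + 1) / 3 := by
    intro n
    induction n with
    | zero => simp
    | succ n ih => rw [sum_range_succ, ih, parabola]; push_cast; ring
  have hlin : (N : ℝ) ^ 3 / 6 ≤ ∑ k ∈ range N, parabola N k := by
    rw [hsum]
    nlinarith [sq_nonneg (N : ℝ), Nat.cast_nonneg (α := ℝ) N]
  have hcs : (∑ k ∈ range N, parabola N k) ^ 2 ≤ N * ∑ k ∈ range N, parabola N k ^ 2 := by
    simpa using sq_sum_le_card_mul_sum_sq (s := range N) (f := parabola N)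
  rcases Nat.eq_zero_or_pos N with rfl | hN
  · simp
  have hN' : (0 : ℝ) < N := by exact_mod_cast hN
  have hsq : ((N : ℝ) ^ 3 / 6) ^ 2 ≤ (∑ k ∈ range N, parabola N k) ^ 2 := by gcongr
  refine le_of_mul_le_mul_left ?_ hN'
  nlinarith

theorem parabola_sub_sq_le {N k : ℕ} (hk : k ∈ Ico 1 N) :
    (parabola N k - parabola N (k - 1)) ^ 2 ≤ (N : ℝ) ^ 2 := by
  obtain ⟨h1, h2⟩ := mem_Ico.1 hk
  obtain ⟨m, rfl⟩ := Nat.exists_eq_add_of_le' h1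
  have hm : (m : ℝ) + 1 ≤ N := by exact_mod_cast h2.le
  have hm0 : (0 : ℝ) ≤ m := Nat.cast_nonneg m
  simp only [parabola, Nat.add_sub_cancel]
  push_cast
  apply sq_le_sq' <;> nlinarith

end OneDimensional

section Grid

open Finset

theorem gridExt_apply {Nx Ny Nz i j k : ℕ} (p : Fin Nx × Fin Ny × Fin Nz → ℝ)
    (hi : i < Nx) (hj : j < Ny) (hk : k < Nz) :
    gridExt Nx Ny Nz p i j k = p (⟨i, hi⟩, ⟨j, hj⟩, ⟨k, hk⟩) := by
  simp [gridExt, hi, hj, hk]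

theorem dotProduct_self_eq_sum_gridExt {Nx Ny Nz : ℕ} (p : Fin Nx × Fin Ny × Fin Nz → ℝ) :
    p ⬝ᵥ p = ∑ i ∈ range Nx, ∑ j ∈ range Ny, ∑ k ∈ range Nz, gridExt Nx Ny Nz p i j k ^ 2 := by
  simp only [dotProduct, Fintype.sum_prod_type, sum_range, gridExt_apply, Fin.is_lt, Fin.eta, sq]

variable {Nx Ny Nz : ℕ} {κx κy κz : ℕ → ℕ → ℕ → ℝ} {κin κout : ℕ → ℕ → ℝ} {K' K'' : ℝ}

theorem mul_sq_sub_le {κ c : ℝ} (h0 : 0 ≤ κ) (h : κ ≤ c) (a b : ℝ) :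
    κ * (a - b) ^ 2 ≤ c * (2 * a ^ 2 + 2 * b ^ 2) := by
  refine mul_le_mul h ?_ (sq_nonneg _) (h0.trans h)
  nlinarith [sq_nonneg (a + b)]

theorem quadForm_le (hz : 1 ≤ Nz) (hK : 0 ≤ K')
    (hx : ∀ i ∈ Ico 1 Nx, ∀ j ∈ range Ny, ∀ k ∈ range Nz, κx i j k ∈ Set.Icc K' K'')
    (hy : ∀ i ∈ range Nx, ∀ j ∈ Ico 1 Ny, ∀ k ∈ range Nz, κy i j k ∈ Set.Icc K' K'')
    (hzz : ∀ i ∈ range Nx, ∀ j ∈ range Ny, ∀ k ∈ Ico 1 Nz, κz i j k ∈ Set.Icc K' K'')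
    (hin : ∀ i ∈ range Nx, ∀ j ∈ range Ny, κin i j ∈ Set.Icc K' K'')
    (hout : ∀ i ∈ range Nx, ∀ j ∈ range Ny, κout i j ∈ Set.Icc K' K'')
    (hK'' : 0 ≤ K'') (u : ℕ → ℕ → ℕ → ℝ) :
    quadForm Nx Ny Nz κx κy κz κin κout u ≤
      16 * K'' * ∑ i ∈ range Nx, ∑ j ∈ range Ny, ∑ k ∈ range Nz, u i j k ^ 2 := by
  set S := ∑ i ∈ range Nx, ∑ j ∈ range Ny, ∑ k ∈ range Nz, u i j k ^ 2 with hS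
  have h1 : ∑ i ∈ Ico 1 Nx, ∑ j ∈ range Ny, ∑ k ∈ range Nz,
      κx i j k * (u i j k - u (i - 1) j k) ^ 2 ≤ 4 * K'' * S := by
    refine sum_Ico_one_le_four_mul_sum hK'' (fun i => by positivity) fun i hi => ?_
    simp only [mul_sum, ← sum_add_distrib]
    refine sum_le_sum fun j hj => sum_le_sum fun k hk => ?_
    have := hx i hi j hj k hk
    simpa [mul_add] using mul_sq_sub_le (hK.trans this.1) this.2 (u i j k) (u (i - 1) j k)
  have h2 : ∑ i ∈ range Nx, ∑ j ∈ Ico 1 Ny, ∑ k ∈ range Nz,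
      κy i j k * (u i j k - u i (j - 1) k) ^ 2 ≤ 4 * K'' * S := by
    rw [hS, mul_sum]
    refine sum_le_sum fun i hi => ?_
    refine sum_Ico_one_le_four_mul_sum hK'' (fun j => by positivity) fun j hj => ?_
    simp only [mul_sum, ← sum_add_distrib]
    refine sum_le_sum fun k hk => ?_
    have := hy i hi j hj k hk
    simpa [mul_add] using mul_sq_sub_le (hK.trans this.1) this.2 (u i j k) (u i (j - 1) k)
  have h3 : ∑ i ∈ range Nx, ∑ j ∈ range Ny, ∑ k ∈ Ico 1 Nz,
      κz i j k * (u i j k - u i j (k - 1)) ^ 2 ≤ 4 * K'' * S := by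
    rw [hS, mul_sum]
    refine sum_le_sum fun i hi => ?_
    rw [mul_sum]
    refine sum_le_sum fun j hj => ?_
    refine sum_Ico_one_le_four_mul_sum hK'' (fun k => by positivity) fun k hk => ?_
    have := hzz i hi j hj k hk
    exact mul_sq_sub_le (hK.trans this.1) this.2 (u i j k) (u i j (k - 1))
  have hbdry : ∀ κ : ℕ → ℕ → ℝ, (∀ i ∈ range Nx, ∀ j ∈ range Ny, κ i j ∈ Set.Icc K' K'') →
      ∀ k < Nz, ∑ i ∈ range Nx, ∑ j ∈ range Ny, 2 * κ i j * u i j k ^ 2 ≤ 2 * K'' * S := by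
    intro κ hκ k hk
    rw [hS, mul_sum]
    refine sum_le_sum fun i hi => ?_
    rw [mul_sum]
    refine sum_le_sum fun j hj => ?_
    have hle := single_le_sum (f := fun k => u i j k ^ 2) (fun k _ => sq_nonneg _)
      (mem_range.2 hk)
    have := (hκ i hi j hj).2
    exact mul_le_mul (by linarith) hle (sq_nonneg _) (by positivity)
  have h4 := hbdry κin hin 0 (by omega)
  have h5 := hbdry κout hout (Nz - 1) (by omega)
  unfold quadForm
  linarith

theorem le_quadForm (hK : 0 ≤ K')
    (hx : ∀ i ∈ Ico 1 Nx, ∀ j ∈ range Ny, ∀ k ∈ range Nz, κx i j k ∈ Set.Icc K' K'')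
    (hy : ∀ i ∈ range Nx, ∀ j ∈ Ico 1 Ny, ∀ k ∈ range Nz, κy i j k ∈ Set.Icc K' K'')
    (hzz : ∀ i ∈ range Nx, ∀ j ∈ range Ny, ∀ k ∈ Ico 1 Nz, κz i j k ∈ Set.Icc K' K'')
    (hin : ∀ i ∈ range Nx, ∀ j ∈ range Ny, κin i j ∈ Set.Icc K' K'')
    (hout : ∀ i ∈ range Nx, ∀ j ∈ range Ny, κout i j ∈ Set.Icc K' K'')
    (u : ℕ → ℕ → ℕ → ℝ) :
    ∑ i ∈ range Nx, ∑ j ∈ range Ny,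
      (∑ k ∈ Ico 1 Nz, K' * (u i j k - u i j (k - 1)) ^ 2 + 2 * K' * u i j 0 ^ 2) ≤
      quadForm Nx Ny Nz κx κy κz κin κout u := by
  have h1 : 0 ≤ ∑ i ∈ Ico 1 Nx, ∑ j ∈ range Ny, ∑ k ∈ range Nz,
      κx i j k * (u i j k - u (i - 1) j k) ^ 2 :=
    sum_nonneg fun i hi => sum_nonneg fun j hj => sum_nonneg fun k hk =>
      mul_nonneg (hK.trans (hx i hi j hj k hk).1) (sq_nonneg _)
  have h2 : 0 ≤ ∑ i ∈ range Nx, ∑ j ∈ Ico 1 Ny, ∑ k ∈ range Nz,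
      κy i j k * (u i j k - u i (j - 1) k) ^ 2 :=
    sum_nonneg fun i hi => sum_nonneg fun j hj => sum_nonneg fun k hk =>
      mul_nonneg (hK.trans (hy i hi j hj k hk).1) (sq_nonneg _)
  have h3 : ∑ i ∈ range Nx, ∑ j ∈ range Ny, ∑ k ∈ Ico 1 Nz,
      K' * (u i j k - u i j (k - 1)) ^ 2 ≤ ∑ i ∈ range Nx, ∑ j ∈ range Ny, ∑ k ∈ Ico 1 Nz,
      κz i j k * (u i j k - u i j (k - 1)) ^ 2 :=
    sum_le_sum fun i hi => sum_le_sum fun j hj => sum_le_sum fun k hk =>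
      mul_le_mul_of_nonneg_right (hzz i hi j hj k hk).1 (sq_nonneg _)
  have h4 : ∑ i ∈ range Nx, ∑ j ∈ range Ny, 2 * K' * u i j 0 ^ 2 ≤
      ∑ i ∈ range Nx, ∑ j ∈ range Ny, 2 * κin i j * u i j 0 ^ 2 :=
    sum_le_sum fun i hi => sum_le_sum fun j hj => by
      have := (hin i hi j hj).1
      gcongr
  have h5 : 0 ≤ ∑ i ∈ range Nx, ∑ j ∈ range Ny, 2 * κout i j * u i j (Nz - 1) ^ 2 :=
    sum_nonneg fun i hi => sum_nonneg fun j hj =>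
      mul_nonneg (mul_nonneg zero_le_two (hK.trans (hout i hi j hj).1)) (sq_nonneg _)
  simp only [sum_add_distrib]
  unfold quadForm
  linarith

theorem mul_sum_sq_le_vertical_energy (hK : 0 ≤ K') (u : ℕ → ℕ → ℕ → ℝ) :
    K' * ∑ i ∈ range Nx, ∑ j ∈ range Ny, ∑ k ∈ range Nz, u i j k ^ 2 ≤
      (Nz : ℝ) ^ 2 * ∑ i ∈ range Nx, ∑ j ∈ range Ny,
        (∑ k ∈ Ico 1 Nz, K' * (u i j k - u i j (k - 1)) ^ 2 + 2 * K' * u i j 0 ^ 2) := by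
  rw [mul_sum, mul_sum]
  refine sum_le_sum fun i _ => ?_
  rw [mul_sum, mul_sum]
  refine sum_le_sum fun j _ => ?_
  rw [← mul_sum]
  have h := mul_le_mul_of_nonneg_left (sum_sq_le_sq_mul_energy (u i j) Nz) hK
  have h0 : 0 ≤ (Nz : ℝ) ^ 2 * (K' * u i j 0 ^ 2) := by positivity
  linarith

theorem quadForm_parabola_le (hz : 1 ≤ Nz) (hK : 0 ≤ K'')
    (hzz : ∀ i ∈ range Nx, ∀ j ∈ range Ny, ∀ k ∈ Ico 1 Nz, κz i j k ≤ K'')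
    (hin : ∀ i ∈ range Nx, ∀ j ∈ range Ny, κin i j ≤ K'')
    (hout : ∀ i ∈ range Nx, ∀ j ∈ range Ny, κout i j ≤ K'')
    {u : ℕ → ℕ → ℕ → ℝ} (hu : ∀ i < Nx, ∀ j < Ny, ∀ k < Nz, u i j k = parabola Nz k) :
    quadForm Nx Ny Nz κx κy κz κin κout u ≤ Nx * Ny * (5 * K'' * (Nz : ℝ) ^ 3) := by
  have hNz : (1 : ℝ) ≤ Nz := by exact_mod_cast hz
  have hpow : K'' * (Nz : ℝ) ^ 2 ≤ K'' * (Nz : ℝ) ^ 3 := by gcongr; norm_num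
  have h1 : ∑ i ∈ Ico 1 Nx, ∑ j ∈ range Ny, ∑ k ∈ range Nz,
      κx i j k * (u i j k - u (i - 1) j k) ^ 2 = 0 := by
    refine sum_eq_zero fun i hi => sum_eq_zero fun j hj => sum_eq_zero fun k hk => ?_
    simp only [mem_Ico, mem_range] at hi hj hk
    rw [hu i hi.2 j hj k hk, hu (i - 1) (by omega) j hj k hk]
    ring
  have h2 : ∑ i ∈ range Nx, ∑ j ∈ Ico 1 Ny, ∑ k ∈ range Nz,
      κy i j k * (u i j k - u i (j - 1) k) ^ 2 = 0 := by
    refine sum_eq_zero fun i hi => sum_eq_zero fun j hj => sum_eq_zero fun k hk => ?_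
    simp only [mem_Ico, mem_range] at hi hj hk
    rw [hu i hi j hj.2 k hk, hu i hi (j - 1) (by omega) k hk]
    ring
  have hconst : ∀ {g : ℕ → ℕ → ℝ} {c : ℝ}, (∀ i ∈ range Nx, ∀ j ∈ range Ny, g i j ≤ c) →
      ∑ i ∈ range Nx, ∑ j ∈ range Ny, g i j ≤ Nx * Ny * c := by
    intro g c hg
    refine (sum_le_sum fun i hi => sum_le_sum fun j hj => hg i hi j hj).trans_eq ?_
    simp [mul_assoc]
  have h3 : ∑ i ∈ range Nx, ∑ j ∈ range Ny, ∑ k ∈ Ico 1 Nz,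
      κz i j k * (u i j k - u i j (k - 1)) ^ 2 ≤ Nx * Ny * (K'' * (Nz : ℝ) ^ 3) := by
    refine hconst fun i hi j hj => ?_
    have hterm : ∀ k ∈ Ico 1 Nz,
        κz i j k * (u i j k - u i j (k - 1)) ^ 2 ≤ K'' * (Nz : ℝ) ^ 2 := by
      intro k hk
      have hk' := mem_Ico.1 hk
      rw [hu i (mem_range.1 hi) j (mem_range.1 hj) k hk'.2,
        hu i (mem_range.1 hi) j (mem_range.1 hj) (k - 1) (by omega)]
      exact mul_le_mul (hzz i hi j hj k hk) (parabola_sub_sq_le hk) (sq_nonneg _) hK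
    refine (sum_le_sum hterm).trans ?_
    rw [sum_const, Nat.card_Ico, nsmul_eq_mul, Nat.cast_sub hz, Nat.cast_one]
    have : 0 ≤ K'' * (Nz : ℝ) ^ 2 := by positivity
    nlinarith
  have hbdry : ∀ κ : ℕ → ℕ → ℝ, (∀ i ∈ range Nx, ∀ j ∈ range Ny, κ i j ≤ K'') →
      ∀ k < Nz, parabola Nz k = Nz →
      ∑ i ∈ range Nx, ∑ j ∈ range Ny, 2 * κ i j * u i j k ^ 2 ≤
        Nx * Ny * (2 * (K'' * (Nz : ℝ) ^ 3)) := by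
    intro κ hκ k hk hpk
    refine hconst fun i hi j hj => ?_
    rw [hu i (mem_range.1 hi) j (mem_range.1 hj) k hk, hpk]
    have := mul_le_mul_of_nonneg_right (hκ i hi j hj) (sq_nonneg (Nz : ℝ))
    linarith
  have h4 := hbdry κin hin 0 (by omega) (by simp [parabola])
  have h5 := hbdry κout hout (Nz - 1) (by omega) (by
    simp [parabola, Nat.cast_sub hz])
  unfold quadForm
  rw [h1, h2]
  linarith

end Grid

theorem stmt_1 : ∃ C₁ C₂ : ℝ, 0 < C₁ ∧ 0 < C₂ ∧
    ∀ (Nx Ny Nz : ℕ), 2 ≤ Nx → 2 ≤ Ny → 2 ≤ Nz →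
    ∀ (K' K'' : ℝ), 0 < K' → K' ≤ K'' →
    ∀ (κx κy κz : ℕ → ℕ → ℕ → ℝ) (κin κout : ℕ → ℕ → ℝ),
    (∀ i ∈ Finset.Ico 1 Nx, ∀ j ∈ Finset.range Ny, ∀ k ∈ Finset.range Nz,
      κx i j k ∈ Set.Icc K' K'') →
    (∀ i ∈ Finset.range Nx, ∀ j ∈ Finset.Ico 1 Ny, ∀ k ∈ Finset.range Nz,
      κy i j k ∈ Set.Icc K' K'') →
    (∀ i ∈ Finset.range Nx, ∀ j ∈ Finset.range Ny, ∀ k ∈ Finset.Ico 1 Nz,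
      κz i j k ∈ Set.Icc K' K'') →
    (∀ i ∈ Finset.range Nx, ∀ j ∈ Finset.range Ny, κin i j ∈ Set.Icc K' K'') →
    (∀ i ∈ Finset.range Nx, ∀ j ∈ Finset.range Ny, κout i j ∈ Set.Icc K' K'') →
    ∀ A : Matrix (Fin Nx × Fin Ny × Fin Nz) (Fin Nx × Fin Ny × Fin Nz) ℝ,
    A.IsSymm →
    (∀ p : Fin Nx × Fin Ny × Fin Nz → ℝ,
      p ⬝ᵥ A.mulVec p = quadForm Nx Ny Nz κx κy κz κin κout (gridExt Nx Ny Nz p)) →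
    C₁ * (K' / K'') * (Nz : ℝ) ^ 2 ≤ condNum A ∧
    condNum A ≤ C₂ * (K'' / K') * (Nz : ℝ) ^ 2 := by
  refine ⟨1 / 90, 16, by norm_num, by norm_num, ?_⟩
  intro Nx Ny Nz hNx hNy hNz K' K'' hK' hK κx κy κz κin κout hx hy hz hin hout A hA hq
  have hK'' : 0 < K'' := hK'.trans_le hK
  have hN : (0 : ℝ) < Nz := by exact_mod_cast (by omega : 0 < Nz)
  have hupper : ∀ p, p ⬝ᵥ A.mulVec p ≤ 16 * K'' * (p ⬝ᵥ p) := fun p => by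
    rw [hq, dotProduct_self_eq_sum_gridExt]
    exact quadForm_le (by omega) hK'.le hx hy hz hin hout hK''.le _
  have hlower : ∀ p, K' / (Nz : ℝ) ^ 2 * (p ⬝ᵥ p) ≤ p ⬝ᵥ A.mulVec p := fun p => by
    rw [hq, dotProduct_self_eq_sum_gridExt, div_mul_eq_mul_div, div_le_iff₀' (by positivity)]
    exact (mul_sum_sq_le_vertical_energy hK'.le _).trans (by
      gcongr
      exact le_quadForm hK'.le hx hy hz hin hout _)
  have hmem_le : ∀ μ ∈ eigSet A, μ ≤ 16 * K'' := fun μ hμ => ge_of_mem_eigSet hupper hμ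
  have hle_mem : ∀ μ ∈ eigSet A, K' / (Nz : ℝ) ^ 2 ≤ μ := fun μ hμ => le_of_mem_eigSet hlower hμ
  let o : Fin Nx × Fin Ny × Fin Nz := (⟨0, by omega⟩, ⟨0, by omega⟩, ⟨0, by omega⟩)
  have hne : (eigSet A).Nonempty :=
    ⟨_, mem_eigSet_eigenvalues
      (by rw [Matrix.IsHermitian, Matrix.conjTranspose_eq_transpose_of_trivial, hA.eq]) o⟩
  have hsup_le : sSup (eigSet A) ≤ 16 * K'' := csSup_le hne hmem_le
  have hle_inf : K' / (Nz : ℝ) ^ 2 ≤ sInf (eigSet A) := le_csInf hne hle_mem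
  have hinf_pos : 0 < sInf (eigSet A) := lt_of_lt_of_le (by positivity) hle_inf
  have hle_sup : 2 * K' ≤ sSup (eigSet A) := by
    have h := dotProduct_le_mul_of_eigSet_le hA (fun μ hμ => le_csSup ⟨_, hmem_le⟩ hμ)
      (Pi.single o 1)
    have hnorm : (Pi.single o 1 : Fin Nx × Fin Ny × Fin Nz → ℝ) ⬝ᵥ Pi.single o 1 = 1 := by simp
    rw [hnorm, mul_one, hq] at h
    refine le_trans ?_ h
    refine le_trans ?_ (le_quadForm hK'.le hx hy hz hin hout _)
    set u := gridExt Nx Ny Nz (Pi.single o 1)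
    have hu : u 0 0 0 = 1 := by
      simp only [u]
      rw [gridExt_apply _ (by omega) (by omega) (by omega)]
      exact Pi.single_eq_same o 1
    have hnn : ∀ i j, 0 ≤ ∑ k ∈ Finset.Ico 1 Nz, K' * (u i j k - u i j (k - 1)) ^ 2 +
        2 * K' * u i j 0 ^ 2 := fun i j => by positivity
    calc 2 * K' ≤ ∑ k ∈ Finset.Ico 1 Nz, K' * (u 0 0 k - u 0 0 (k - 1)) ^ 2 +
        2 * K' * u 0 0 0 ^ 2 := by
          rw [hu, one_pow, mul_one]
          exact le_add_of_nonneg_left (by positivity)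
      _ ≤ ∑ j ∈ Finset.range Ny, (∑ k ∈ Finset.Ico 1 Nz, K' * (u 0 j k - u 0 j (k - 1)) ^ 2 +
        2 * K' * u 0 j 0 ^ 2) :=
          Finset.single_le_sum (f := fun j => ∑ k ∈ Finset.Ico 1 Nz,
            K' * (u 0 j k - u 0 j (k - 1)) ^ 2 + 2 * K' * u 0 j 0 ^ 2)
            (fun j _ => hnn 0 j) (Finset.mem_range.2 (by omega))
      _ ≤ _ :=
          Finset.single_le_sum (f := fun i => ∑ j ∈ Finset.range Ny, (∑ k ∈ Finset.Ico 1 Nz,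
            K' * (u i j k - u i j (k - 1)) ^ 2 + 2 * K' * u i j 0 ^ 2))
            (fun i _ => Finset.sum_nonneg fun j _ => hnn i j) (Finset.mem_range.2 (by omega))
  have hinf_le : sInf (eigSet A) ≤ 180 * K'' / (Nz : ℝ) ^ 2 := by
    let p : Fin Nx × Fin Ny × Fin Nz → ℝ := fun x => parabola Nz x.2.2
    have hu : ∀ i < Nx, ∀ j < Ny, ∀ k < Nz, gridExt Nx Ny Nz p i j k = parabola Nz k :=
      fun i hi j hj k hk => gridExt_apply p hi hj hk
    have h := mul_dotProduct_le_of_le_eigSet hA (fun μ hμ => csInf_le ⟨_, hle_mem⟩ hμ) p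
    rw [hq] at h
    have henergy := h.trans (quadForm_parabola_le (by omega) hK''.le
      (fun i hi j hj k hk => (hz i hi j hj k hk).2) (fun i hi j hj => (hin i hi j hj).2)
      (fun i hi j hj => (hout i hi j hj).2) hu)
    have hnorm : p ⬝ᵥ p = Nx * Ny * ∑ k ∈ Finset.range Nz, parabola Nz k ^ 2 := by
      simp [p, dotProduct, Fintype.sum_prod_type, Finset.sum_range, sq, mul_assoc]
    have hNxy : (0 : ℝ) < Nx * Ny := by
      exact_mod_cast Nat.mul_pos (by omega : 0 < Nx) (by omega : 0 < Ny)
    rw [hnorm, mul_left_comm] at henergy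
    have hred := le_of_mul_le_mul_left henergy hNxy
    have hmass := mul_le_mul_of_nonneg_left (pow_five_le_sum_parabola_sq Nz) hinf_pos.le
    rw [le_div_iff₀ (by positivity)]
    refine le_of_mul_le_mul_right ?_ (pow_pos hN 3)
    linarith
  constructor
  · rw [condNum, le_div_iff₀ hinf_pos]
    calc 1 / 90 * (K' / K'') * (Nz : ℝ) ^ 2 * sInf (eigSet A)
        ≤ 1 / 90 * (K' / K'') * (Nz : ℝ) ^ 2 * (180 * K'' / (Nz : ℝ) ^ 2) := by gcongr
      _ = 2 * K' := by field_simp; norm_num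
      _ ≤ _ := hle_sup
  · rw [condNum, div_le_iff₀ hinf_pos]
    calc sSup (eigSet A) ≤ 16 * K'' := hsup_le
      _ = 16 * (K'' / K') * (Nz : ℝ) ^ 2 * (K' / (Nz : ℝ) ^ 2) := by field_simp
      _ ≤ _ := by gcongr
end

section
/- The DCT diagonalizes the first-difference quadratic form: for every N ≥ 1 and all u, w ∈ ℝ^N, Σ_{i=1}^{N−1} (u_i − u_{i−1})(w_i − w_{i−1}) = (4/N) Σ_{k=0}^{N−1} α_k (1 − cos(kπ/N)) û_k ŵ_k, where û and ŵ are the forward DCTs of u and w. -/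
/-- The forward discrete cosine transform (DCT-2) of length `N`:
`û_k = Σ_{i=0}^{N−1} u_i cos(π(2i+1)k/(2N))`. -/
noncomputable def dct (N : ℕ) (u : ℕ → ℝ) (k : ℕ) : ℝ :=
  ∑ i ∈ Finset.range N, u i * Real.cos (Real.pi * (2 * i + 1) * k / (2 * N))

/-- The weight `α_k`: `1/2` if `k = 0` and `1` otherwise. -/
noncomputable def dctα (k : ℕ) : ℝ := if k = 0 then 1 / 2 else 1

theorem sum_range_cos_pi_mul_div {N m : ℕ} (hm : 0 < m) (hmN : m < 2 * N) :
    ∑ k ∈ Finset.range N, Real.cos (Real.pi * m * k / N) = (1 - (-1) ^ m) / 2 := by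
  have hN : (0 : ℝ) < N := by
    have : 0 < N := by omega
    exact_mod_cast this
  have hm' : (0 : ℝ) < m := by exact_mod_cast hm
  have hmN' : (m : ℝ) < 2 * N := by exact_mod_cast hmN
  set y : ℝ := Real.pi * m / (2 * N) with hy
  have hsin : 0 < Real.sin y := by
    apply Real.sin_pos_of_pos_of_lt_pi
    · positivity
    · rw [hy, div_lt_iff₀ (by positivity)]
      exact mul_lt_mul_of_pos_left hmN' Real.pi_pos
  have telescope (n : ℕ) : 2 * Real.sin y * ∑ k ∈ Finset.range n, Real.cos (2 * y * k)
      = Real.sin (2 * y * n - y) + Real.sin y := by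
    induction n with
    | zero => simp
    | succ n ih =>
      rw [Finset.sum_range_succ, mul_add, ih]
      push_cast
      rw [show 2 * y * ((n : ℝ) + 1) - y = 2 * y * n + y by ring, Real.sin_add, Real.sin_sub]
      ring
  have hcos (k : ℕ) : Real.cos (Real.pi * m * k / N) = Real.cos (2 * y * k) := by
    congr 1
    rw [hy]
    field_simp
  have hend : Real.sin (2 * y * N - y) = -((-1) ^ m * Real.sin y) := by
    rw [show 2 * y * N - y = m * Real.pi - y by rw [hy]; field_simp]
    exact Real.sin_nat_mul_pi_sub y m
  have key := telescope N
  simp_rw [hcos]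
  apply mul_left_cancel₀ (mul_ne_zero two_ne_zero hsin.ne')
  rw [key, hend]
  ring

theorem sum_range_sin_mul_sin_of_lt {N i j : ℕ} (hij : j < i) (hi : i < N) :
    ∑ k ∈ Finset.range N, Real.sin (Real.pi * i * k / N) * Real.sin (Real.pi * j * k / N)
      = 0 := by
  obtain ⟨d, rfl⟩ := Nat.exists_eq_add_of_lt hij
  have hdiff := sum_range_cos_pi_mul_div (N := N) (m := d + 1) (by omega) (by omega)
  have hsum := sum_range_cos_pi_mul_div (N := N) (m := 2 * j + (d + 1)) (by omega) (by omega)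
  rw [pow_add, pow_mul, neg_one_sq, one_pow, one_mul, ← hdiff] at hsum
  have hprod (k : ℕ) :
      Real.sin (Real.pi * (j + d + 1 : ℕ) * k / N) * Real.sin (Real.pi * j * k / N)
        = (Real.cos (Real.pi * (d + 1 : ℕ) * k / N)
          - Real.cos (Real.pi * (2 * j + (d + 1) : ℕ) * k / N)) / 2 := by
    rw [show Real.pi * (d + 1 : ℕ) * k / N
        = Real.pi * (j + d + 1 : ℕ) * k / N - Real.pi * j * k / N by push_cast; ring,
      show Real.pi * (2 * j + (d + 1) : ℕ) * k / N
        = Real.pi * (j + d + 1 : ℕ) * k / N + Real.pi * j * k / N by push_cast; ring,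
      Real.cos_sub, Real.cos_add]
    ring
  simp_rw [hprod]
  rw [← Finset.sum_div, Finset.sum_sub_distrib, hsum]
  simp

theorem sum_range_sin_sq {N i : ℕ} (hi0 : 0 < i) (hi : i < N) :
    ∑ k ∈ Finset.range N, Real.sin (Real.pi * i * k / N) * Real.sin (Real.pi * i * k / N)
      = N / 2 := by
  have hsum := sum_range_cos_pi_mul_div (N := N) (m := 2 * i) (by omega) (by omega)
  have hprod (k : ℕ) : Real.sin (Real.pi * i * k / N) * Real.sin (Real.pi * i * k / N)
      = (1 - Real.cos (Real.pi * (2 * i : ℕ) * k / N)) / 2 := by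
    rw [show Real.pi * (2 * i : ℕ) * k / N = 2 * (Real.pi * i * k / N) by push_cast; ring,
      Real.cos_two_mul, Real.cos_sq']
    ring
  simp_rw [hprod]
  rw [← Finset.sum_div, Finset.sum_sub_distrib, hsum, pow_mul]
  simp

/-- Orthogonality of the discrete sine transform (DST-1). -/
theorem sum_range_sin_mul_sin {N i j : ℕ} (hi : i ∈ Finset.Ico 1 N) (hj : j ∈ Finset.Ico 1 N) :
    ∑ k ∈ Finset.range N, Real.sin (Real.pi * i * k / N) * Real.sin (Real.pi * j * k / N)
      = if i = j then (N : ℝ) / 2 else 0 := by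
  rw [Finset.mem_Ico] at hi hj
  rcases lt_trichotomy i j with h | rfl | h
  · simp_rw [if_neg h.ne, mul_comm (Real.sin (Real.pi * i * _ / N))]
    exact sum_range_sin_mul_sin_of_lt h hj.2
  · rw [if_pos rfl]
    exact sum_range_sin_sq hi.1 hi.2
  · rw [if_neg h.ne']
    exact sum_range_sin_mul_sin_of_lt h hi.2

/-- The discrete sine transform (DST-1) of a sequence indexed by `1, …, N - 1`. -/
noncomputable def dst (N : ℕ) (d : ℕ → ℝ) (k : ℕ) : ℝ :=
  ∑ i ∈ Finset.Ico 1 N, d i * Real.sin (Real.pi * i * k / N)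

theorem sum_range_dst_mul_dst (N : ℕ) (d e : ℕ → ℝ) :
    ∑ k ∈ Finset.range N, dst N d k * dst N e k
      = (N : ℝ) / 2 * ∑ i ∈ Finset.Ico 1 N, d i * e i := by
  simp_rw [dst, Finset.sum_mul_sum]
  rw [Finset.sum_comm, Finset.mul_sum]
  refine Finset.sum_congr rfl fun i hi => ?_
  rw [Finset.sum_comm]
  calc ∑ j ∈ Finset.Ico 1 N, ∑ k ∈ Finset.range N,
        d i * Real.sin (Real.pi * i * k / N) * (e j * Real.sin (Real.pi * j * k / N))
      = ∑ j ∈ Finset.Ico 1 N, d i * e j * (if i = j then (N : ℝ) / 2 else 0) := by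
        refine Finset.sum_congr rfl fun j hj => ?_
        rw [← sum_range_sin_mul_sin hi hj, Finset.mul_sum]
        exact Finset.sum_congr rfl fun k _ => by ring
    _ = (N : ℝ) / 2 * (d i * e i) := by
        simp only [mul_ite, mul_zero, Finset.sum_ite_eq, if_pos hi]
        ring

theorem dst_sub_eq_neg_sin_mul_dct {N : ℕ} (hN : 1 ≤ N) (u : ℕ → ℝ) (k : ℕ) :
    dst N (fun i => u i - u (i - 1)) k
      = -(2 * Real.sin (Real.pi * k / (2 * N)) * dct N u k) := by
  have hN0 : (N : ℝ) ≠ 0 := by positivity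
  have hstep (i : ℕ) : 2 * Real.sin (Real.pi * k / (2 * N))
        * Real.cos (Real.pi * (2 * i + 1) * k / (2 * N))
      = Real.sin (Real.pi * (i + 1 : ℕ) * k / N) - Real.sin (Real.pi * i * k / N) := by
    rw [Real.sin_sub_sin,
      show (Real.pi * (i + 1 : ℕ) * k / N - Real.pi * i * k / N) / 2
        = Real.pi * k / (2 * N) by push_cast; field_simp; ring,
      show (Real.pi * (i + 1 : ℕ) * k / N + Real.pi * i * k / N) / 2
        = Real.pi * (2 * i + 1) * k / (2 * N) by push_cast; field_simp; ring]
  have parts (n : ℕ) : ∑ i ∈ Finset.range n,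
        (u (i + 1) - u i) * Real.sin (Real.pi * (i + 1 : ℕ) * k / N)
      = u n * Real.sin (Real.pi * (n + 1 : ℕ) * k / N)
        - ∑ i ∈ Finset.range (n + 1), u i * (Real.sin (Real.pi * (i + 1 : ℕ) * k / N)
          - Real.sin (Real.pi * i * k / N)) := by
    induction n with
    | zero => simp
    | succ n ih =>
      rw [Finset.sum_range_succ, ih, Finset.sum_range_succ _ (n + 1)]
      ring
  obtain ⟨n, rfl⟩ := Nat.exists_eq_add_of_le' hN
  have hend : Real.sin (Real.pi * (n + 1 : ℕ) * k / (n + 1 : ℕ)) = 0 := by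
    rw [show Real.pi * (n + 1 : ℕ) * k / (n + 1 : ℕ) = k * Real.pi by field_simp]
    exact Real.sin_nat_mul_pi k
  rw [dst, dct, Finset.sum_Ico_eq_sum_range, Finset.mul_sum]
  simp only [Nat.add_sub_cancel, add_comm 1]
  rw [parts n, hend, mul_zero, zero_sub]
  congr 1
  refine Finset.sum_congr rfl fun i _ => ?_
  rw [← hstep i]
  ring

theorem stmt_8 (N : ℕ) (hN : 1 ≤ N) (u w : ℕ → ℝ) :
    ∑ i ∈ Finset.Ico 1 N, (u i - u (i - 1)) * (w i - w (i - 1))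
      = (4 / (N : ℝ)) * ∑ k ∈ Finset.range N,
          dctα k * (1 - Real.cos (k * Real.pi / N)) * dct N u k * dct N w k := by
  have hN0 : (N : ℝ) ≠ 0 := by positivity
  have hterm (k : ℕ) : dctα k * (1 - Real.cos (k * Real.pi / N)) * dct N u k * dct N w k
      = dst N (fun i => u i - u (i - 1)) k * dst N (fun i => w i - w (i - 1)) k / 2 := by
    rw [dst_sub_eq_neg_sin_mul_dct hN, dst_sub_eq_neg_sin_mul_dct hN]
    rcases eq_or_ne k 0 with rfl | hk
    · simp
    · rw [dctα, if_neg hk, show k * Real.pi / N = 2 * (Real.pi * k / (2 * N)) by field_simp,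
        Real.cos_two_mul, Real.cos_sq']
      ring
  simp_rw [hterm]
  rw [← Finset.sum_div, sum_range_dst_mul_dst]
  field_simp
  norm_num
end

section
/- For every N ≥ 1 and every 0 ≤ k ≤ N−1, the vector s^k satisfies s^k · s^k = Σ_{i=0}^{N−1} sin²(π(i+1)(k+1)/(N+1)) = (N+1)/2, where · denotes the Euclidean inner product on ℝ^N. -/
open Matrix

theorem sum_sin_sq_mul_four_sin (x : ℝ) (n : ℕ) :
    (∑ i ∈ Finset.range n, Real.sin ((i + 1) * x) ^ 2) * (4 * Real.sin x) =
      (2 * n + 1) * Real.sin x - Real.sin ((2 * n + 1) * x) := by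
  induction n with
  | zero => simp
  | succ n ih =>
    rw [Finset.sum_range_succ, add_mul, ih]
    push_cast
    rw [show (2 * (n : ℝ) + 1) * x = 2 * ((n + 1) * x) - x by ring,
      show (2 * ((n : ℝ) + 1) + 1) * x = 2 * ((n + 1) * x) + x by ring,
      Real.sin_sub, Real.sin_add, Real.cos_two_mul, Real.cos_sq']
    ring

theorem stmt_10 (N : ℕ) (hN : 1 ≤ N) (k : ℕ) (hk : k ≤ N - 1) :
    (fun i : Fin N => Real.sin (Real.pi * ((i : ℕ) + 1) * (k + 1) / (N + 1))) ⬝ᵥ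
        (fun i : Fin N => Real.sin (Real.pi * ((i : ℕ) + 1) * (k + 1) / (N + 1)))
      = ∑ i ∈ Finset.range N, Real.sin (Real.pi * (i + 1) * (k + 1) / (N + 1)) ^ 2 ∧
    ∑ i ∈ Finset.range N, Real.sin (Real.pi * (i + 1) * (k + 1) / (N + 1)) ^ 2
      = ((N : ℝ) + 1) / 2 := by
  refine ⟨?_, ?_⟩
  · rw [dotProduct, Finset.sum_range]
    exact Finset.sum_congr rfl fun i _ => (sq _).symm
  · have hN0 : (0 : ℝ) < N + 1 := by positivity
    have hkN : (k : ℝ) + 1 < N + 1 := by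
      have : k + 1 < N + 1 := by omega
      exact_mod_cast this
    set x : ℝ := Real.pi * (k + 1) / (N + 1) with hx
    have hsin : 0 < Real.sin x := by
      refine Real.sin_pos_of_pos_of_lt_pi (by positivity) ?_
      rw [hx, div_lt_iff₀ hN0]
      exact mul_lt_mul_of_pos_left hkN Real.pi_pos
    have hend : Real.sin ((2 * N + 1) * x) = -Real.sin x := by
      have harg : (2 * N + 1) * x = ((k + 1 : ℕ) : ℝ) * (2 * Real.pi) - x := by
        rw [hx]
        push_cast
        field_simp
        ring
      rw [harg, Real.sin_nat_mul_two_pi_sub]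
    have hsum := sum_sin_sq_mul_four_sin x N
    rw [hend] at hsum
    have hterm (i : ℕ) : Real.pi * (i + 1) * (k + 1) / (N + 1) = (i + 1) * x := by
      rw [hx]
      ring
    simp only [hterm]
    apply mul_right_cancel₀ (mul_pos four_pos hsin).ne'
    rw [hsum]
    ring
end

section
/- Fix integers Nx, Ny ≥ 1, Nz ≥ 1 and indices 0 ≤ i' ≤ Nx−1, 0 ≤ j' ≤ Ny−1. Let T_{i',j'} be the Nz×Nz matrix T_{i',j'} = 2(1 − cos(i'π/Nx))·I + 2(1 − cos(j'π/Ny))·I + B_{Nz} + diag(1, 0, …, 0, 1). Then every eigenvalue λ of T_{i',j'} satisfies λ ≥ 2(3 − cos(i'π/Nx) − cos(j'π/Ny) − cos(π/(Nz+1))). -/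
open Matrix

/-- The `N×N` tridiagonal matrix with all diagonal entries `2` and `−1` on the
sub- and superdiagonal. -/
noncomputable def matB (N : ℕ) : Matrix (Fin N) (Fin N) ℝ := fun i j =>
  if (i : ℕ) = (j : ℕ) then 2
  else if (i : ℕ) + 1 = (j : ℕ) ∨ (j : ℕ) + 1 = (i : ℕ) then -1 else 0

/-- The `N×N` diagonal matrix `diag(1, 0, …, 0, 1)`. -/
noncomputable def matC (N : ℕ) : Matrix (Fin N) (Fin N) ℝ :=
  Matrix.diagonal (fun i : Fin N => if (i : ℕ) = 0 ∨ (i : ℕ) = N - 1 then 1 else 0)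

/-- If the off-diagonal entries of `A` are nonpositive and `μ • w ≤ A *ᵥ w` for some positive
vector `w`, then every real eigenvalue of `A` is at least `μ`. -/
theorem le_eigenvalue_of_smul_le_mulVec {ι : Type*} [Fintype ι] {A : Matrix ι ι ℝ}
    (hA : ∀ i j, i ≠ j → A i j ≤ 0) {w : ι → ℝ} (hw : ∀ i, 0 < w i) {μ : ℝ}
    (hAw : ∀ i, μ * w i ≤ (A *ᵥ w) i) {lam : ℝ} {v : ι → ℝ} (hv : v ≠ 0)
    (heig : A *ᵥ v = lam • v) : μ ≤ lam := by
  wlog hpos : ∃ i, 0 < v i generalizing v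
  · refine this (v := -v) (neg_ne_zero.mpr hv) (by rw [mulVec_neg, heig, smul_neg]) ?_
    push Not at hpos
    obtain ⟨i, hi⟩ := Function.ne_iff.mp hv
    exact ⟨i, neg_pos.mpr (lt_of_le_of_ne (hpos i) hi)⟩
  obtain ⟨i₀, hi₀⟩ := hpos
  have : Nonempty ι := ⟨i₀⟩
  obtain ⟨k, hk⟩ := Finite.exists_max fun i => v i / w i
  set t := v k / w k with ht
  have ht0 : 0 < t := (div_pos hi₀ (hw i₀)).trans_le (hk i₀)
  have hvk : v k = t * w k := by rw [ht, div_mul_cancel₀ _ (hw k).ne']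
  have hle : (A *ᵥ (t • w - v)) k ≤ 0 := by
    refine Finset.sum_nonpos fun j _ => ?_
    rcases eq_or_ne k j with rfl | hj
    · simp [hvk]
    · refine mul_nonpos_of_nonpos_of_nonneg (hA k j hj) ?_
      simpa using (div_le_iff₀ (hw j)).mp (hk j)
  rw [mulVec_sub, mulVec_smul, heig] at hle
  simp only [Pi.sub_apply, Pi.smul_apply, smul_eq_mul, hvk] at hle
  have h := mul_le_mul_of_nonneg_left (hAw k) ht0.le
  refine le_of_mul_le_mul_right ?_ (mul_pos ht0 (hw k))
  linarith

theorem matB_mulVec_apply {N : ℕ} {g : ℕ → ℝ} (h0 : g 0 = 0) (hN : g (N + 1) = 0) (i : Fin N) :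
    (matB N *ᵥ fun j => g (j + 1)) i = 2 * g (i + 1) - g i - g (i + 2) := by
  obtain ⟨i, hi⟩ := i
  have hsplit : ∀ j : Fin N, matB N ⟨i, hi⟩ j * g (j + 1) =
      (if i = (j : ℕ) then 2 * g (j + 1) else 0) + (if i + 1 = (j : ℕ) then -g (j + 1) else 0)
        + (if i = (j : ℕ) + 1 then -g (j + 1) else 0) := by
    intro j
    simp only [matB]
    split_ifs <;> first | omega | ring
  have hsub : ∑ j ∈ Finset.range N, (if i = j + 1 then -g (j + 1) else 0) = -g i := by
    cases i with
    | zero => simp [h0]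
    | succ m => simp [show m < N by omega]
  have hsup : (if i + 1 < N then -g (i + 2) else 0) = -g (i + 2) := by
    split_ifs with h
    · rfl
    · rw [show i + 2 = N + 1 by omega, hN, neg_zero]
  simp only [mulVec, dotProduct, hsplit]
  rw [Fin.sum_univ_eq_sum_range (fun j => (if i = j then 2 * g (j + 1) else 0)
    + (if i + 1 = j then -g (j + 1) else 0) + (if i = j + 1 then -g (j + 1) else 0)),
    Finset.sum_add_distrib, Finset.sum_add_distrib, hsub, Finset.sum_ite_eq, Finset.sum_ite_eq]
  simp only [Finset.mem_range, hi, if_true, hsup]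
  ring

theorem matB_mulVec_sin (N : ℕ) (i : Fin N) :
    (matB N *ᵥ fun j => Real.sin (((j : ℕ) + 1 : ℕ) * (Real.pi / (N + 1)))) i =
      2 * (1 - Real.cos (Real.pi / (N + 1))) *
        Real.sin (((i : ℕ) + 1 : ℕ) * (Real.pi / (N + 1))) := by
  rw [matB_mulVec_apply (g := fun k : ℕ => Real.sin (k * (Real.pi / (N + 1)))) (by simp)]
  · set θ := Real.pi / ((N : ℝ) + 1)
    have h1 : ((i : ℕ) : ℝ) * θ = ((i : ℕ) + 1 : ℕ) * θ - θ := by push_cast; ring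
    have h2 : (((i : ℕ) + 2 : ℕ) : ℝ) * θ = ((i : ℕ) + 1 : ℕ) * θ + θ := by push_cast; ring
    simp only [h1, h2, Real.sin_sub, Real.sin_add]
    ring
  · have : ((N + 1 : ℕ) : ℝ) * (Real.pi / (N + 1)) = Real.pi := by
      push_cast; field_simp
    simp only [this, Real.sin_pi]

theorem stmt_12 (Nx Ny Nz : ℕ) (hNx : 1 ≤ Nx) (hNy : 1 ≤ Ny) (hNz : 1 ≤ Nz)
    (i' j' : ℕ) (hi' : i' ≤ Nx - 1) (hj' : j' ≤ Ny - 1)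
    (lam : ℝ) (v : Fin Nz → ℝ) (hv : v ≠ 0)
    (heig : ((2 * (1 - Real.cos (i' * Real.pi / Nx))) • (1 : Matrix (Fin Nz) (Fin Nz) ℝ)
        + (2 * (1 - Real.cos (j' * Real.pi / Ny))) • (1 : Matrix (Fin Nz) (Fin Nz) ℝ)
        + matB Nz + matC Nz).mulVec v = lam • v) :
    2 * (3 - Real.cos (i' * Real.pi / Nx) - Real.cos (j' * Real.pi / Ny)
        - Real.cos (Real.pi / (Nz + 1))) ≤ lam := by
  set a := Real.cos (i' * Real.pi / Nx)
  set b := Real.cos (j' * Real.pi / Ny)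
  have hpos : ∀ k : Fin Nz, 0 < Real.sin (((k : ℕ) + 1 : ℕ) * (Real.pi / (Nz + 1))) := by
    intro k
    refine Real.sin_pos_of_pos_of_lt_pi (by positivity) ?_
    have hk : (((k : ℕ) + 1 : ℕ) : ℝ) < Nz + 1 := by exact_mod_cast Nat.succ_lt_succ k.isLt
    rw [← mul_div_assoc, div_lt_iff₀ (by positivity), mul_comm Real.pi]
    exact mul_lt_mul_of_pos_right hk Real.pi_pos
  refine le_eigenvalue_of_smul_le_mulVec ?_ hpos ?_ hv heig
  · intro i j hij
    have hval : (i : ℕ) ≠ j := Fin.val_ne_of_ne hij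
    simp only [Matrix.add_apply, Matrix.smul_apply, one_apply_ne hij, matC,
      diagonal_apply_ne _ hij, matB, if_neg hval, smul_zero, zero_add, add_zero]
    split_ifs <;> norm_num
  · intro i
    have hC : 0 ≤ (matC Nz *ᵥ
        fun k => Real.sin (((k : ℕ) + 1 : ℕ) * (Real.pi / (Nz + 1)))) i := by
      rw [matC, mulVec_diagonal]
      exact mul_nonneg (by split_ifs <;> norm_num) (hpos i).le
    simp only [add_mulVec, smul_mulVec, one_mulVec, Pi.add_apply, Pi.smul_apply, smul_eq_mul,
      matB_mulVec_sin]
    linarith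
end

section
/- Minimizing the spectral ratio over reference parameters is equivalent to a linear program: given positive reals m_x ≤ M_x, m_y ≤ M_y, m_z ≤ M_z, m_in ≤ M_in, m_out ≤ M_out, define for each positive 5-tuple r = (r_x, r_y, r_z, r_in, r_out) the quantities Λ'(r) = min{m_x/r_x, m_y/r_y, m_z/r_z, m_in/r_in, m_out/r_out} and Λ''(r) = max{M_x/r_x, M_y/r_y, M_z/r_z, M_in/r_in, M_out/r_out}. Then inf over positive r of Λ''(r)/Λ'(r) equals exp(V), where V is the infimum of λ'' − λ' over all (c_x, c_y, c_z, c_in, c_out, λ', λ'') ∈ ℝ⁷ satisfying c_x + λ' ≤ log m_x, c_y + λ' ≤ log m_y, c_z + λ' ≤ log m_z, c_in + λ' ≤ log m_in, c_out + λ' ≤ log m_out, c_x + λ'' ≥ log M_x, c_y + λ'' ≥ log M_y, c_z + λ'' ≥ log M_z, c_in + λ'' ≥ log M_in, and c_out + λ'' ≥ log M_out. -/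
/-- The ratio of two bounds is at most the ratio of their rescalings by a common factor, once these
are relaxed in the unfavourable directions. -/
theorem div_le_div_of_rescaled_bounds {m M r a b : ℝ} (hm : 0 < m) (hr : 0 < r) (hb : 0 < b)
    (hM : 0 ≤ M) (ha : M / r ≤ a) (hbm : b ≤ m / r) : M / m ≤ a / b := by
  calc M / m = (M / r) / (m / r) := by field_simp
    _ ≤ a / b := div_le_div₀ ((div_nonneg hM hr.le).trans ha) ha hb hbm

/-- Two numbers trapped around a shifted logarithmic window have ratio at most the exponential
of the width of the window. -/
theorem div_le_exp_of_log_window {m M c a b : ℝ} (hm : 0 < m) (hM : 0 < M)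
    (hb : c + b ≤ Real.log m) (ha : Real.log M ≤ c + a) : M / m ≤ Real.exp (a - b) := by
  rw [← Real.log_le_iff_le_exp (div_pos hM hm), Real.log_div hM.ne' hm.ne']
  linarith

/-- A number is bounded, logarithmically, by any majorant of its ratio to another one. -/
theorem log_le_log_add_log_of_div_le {m M K : ℝ} (hm : 0 < m) (hM : 0 < M) (h : M / m ≤ K) :
    Real.log M ≤ Real.log m + Real.log K := by
  have := Real.log_le_log (div_pos hM hm) h
  rw [Real.log_div hM.ne' hm.ne'] at this
  linarith

theorem stmt_15 (mx Mx my My mz Mz mIn MIn mOut MOut : ℝ)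
    (hmx : 0 < mx) (hx : mx ≤ Mx) (hmy : 0 < my) (hy : my ≤ My)
    (hmz : 0 < mz) (hz : mz ≤ Mz) (hmIn : 0 < mIn) (hIn : mIn ≤ MIn)
    (hmOut : 0 < mOut) (hOut : mOut ≤ MOut) :
    sInf {t : ℝ | ∃ rx ry rz rin rout : ℝ,
        0 < rx ∧ 0 < ry ∧ 0 < rz ∧ 0 < rin ∧ 0 < rout ∧
        t = max (max (max (max (Mx / rx) (My / ry)) (Mz / rz)) (MIn / rin)) (MOut / rout)
            / min (min (min (min (mx / rx) (my / ry)) (mz / rz)) (mIn / rin)) (mOut / rout)}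
      = Real.exp (sInf {t : ℝ | ∃ cx cy cz cin cout l' l'' : ℝ,
          cx + l' ≤ Real.log mx ∧ cy + l' ≤ Real.log my ∧ cz + l' ≤ Real.log mz ∧
          cin + l' ≤ Real.log mIn ∧ cout + l' ≤ Real.log mOut ∧
          Real.log Mx ≤ cx + l'' ∧ Real.log My ≤ cy + l'' ∧ Real.log Mz ≤ cz + l'' ∧
          Real.log MIn ≤ cin + l'' ∧ Real.log MOut ≤ cout + l'' ∧
          t = l'' - l'}) := by
  have hMx := hmx.trans_le hx
  have hMy := hmy.trans_le hy
  have hMz := hmz.trans_le hz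
  have hMIn := hmIn.trans_le hIn
  have hMOut := hmOut.trans_le hOut
  obtain ⟨K, hK⟩ : ∃ K, K = max (max (max (max (Mx / mx) (My / my)) (Mz / mz)) (MIn / mIn))
    (MOut / mOut) := ⟨_, rfl⟩
  have hKle : ((((Mx / mx ≤ K ∧ My / my ≤ K) ∧ Mz / mz ≤ K) ∧ MIn / mIn ≤ K) ∧
      MOut / mOut ≤ K) := by
    simpa only [max_le_iff] using hK.ge
  obtain ⟨⟨⟨⟨hKx, hKy⟩, hKz⟩, hKIn⟩, hKOut⟩ := hKle
  have hKpos : 0 < K := (div_pos hMx hmx).trans_le hKx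
  have hratio : IsLeast {t : ℝ | ∃ rx ry rz rin rout : ℝ,
      0 < rx ∧ 0 < ry ∧ 0 < rz ∧ 0 < rin ∧ 0 < rout ∧
      t = max (max (max (max (Mx / rx) (My / ry)) (Mz / rz)) (MIn / rin)) (MOut / rout)
          / min (min (min (min (mx / rx) (my / ry)) (mz / rz)) (mIn / rin)) (mOut / rout)} K := by
    constructor
    · refine ⟨mx, my, mz, mIn, mOut, hmx, hmy, hmz, hmIn, hmOut, ?_⟩
      rw [← hK, div_self hmx.ne', div_self hmy.ne', div_self hmz.ne', div_self hmIn.ne',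
        div_self hmOut.ne']
      simp only [min_self, div_one]
    · rintro t ⟨rx, ry, rz, rin, rout, hrx, hry, hrz, hrin, hrout, rfl⟩
      have hb : 0 < min (min (min (min (mx / rx) (my / ry)) (mz / rz)) (mIn / rin))
          (mOut / rout) := by positivity
      rw [hK]
      simp only [max_le_iff]
      refine ⟨⟨⟨⟨div_le_div_of_rescaled_bounds hmx hrx hb hMx.le ?_ ?_,
        div_le_div_of_rescaled_bounds hmy hry hb hMy.le ?_ ?_⟩,
        div_le_div_of_rescaled_bounds hmz hrz hb hMz.le ?_ ?_⟩,
        div_le_div_of_rescaled_bounds hmIn hrin hb hMIn.le ?_ ?_⟩,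
        div_le_div_of_rescaled_bounds hmOut hrout hb hMOut.le ?_ ?_⟩ <;> simp
  have hprog : IsLeast {t : ℝ | ∃ cx cy cz cin cout l' l'' : ℝ,
      cx + l' ≤ Real.log mx ∧ cy + l' ≤ Real.log my ∧ cz + l' ≤ Real.log mz ∧
      cin + l' ≤ Real.log mIn ∧ cout + l' ≤ Real.log mOut ∧
      Real.log Mx ≤ cx + l'' ∧ Real.log My ≤ cy + l'' ∧ Real.log Mz ≤ cz + l'' ∧
      Real.log MIn ≤ cin + l'' ∧ Real.log MOut ≤ cout + l'' ∧
      t = l'' - l'} (Real.log K) := by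
    constructor
    · exact ⟨Real.log mx, Real.log my, Real.log mz, Real.log mIn, Real.log mOut, 0, Real.log K,
        (add_zero _).le, (add_zero _).le, (add_zero _).le, (add_zero _).le, (add_zero _).le,
        log_le_log_add_log_of_div_le hmx hMx hKx, log_le_log_add_log_of_div_le hmy hMy hKy,
        log_le_log_add_log_of_div_le hmz hMz hKz, log_le_log_add_log_of_div_le hmIn hMIn hKIn,
        log_le_log_add_log_of_div_le hmOut hMOut hKOut, (sub_zero _).symm⟩
    · rintro t ⟨cx, cy, cz, cin, cout, l', l'', h1, h2, h3, h4, h5, g1, g2, g3, g4, g5, rfl⟩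
      rw [Real.log_le_iff_le_exp hKpos, hK]
      simp only [max_le_iff]
      exact ⟨⟨⟨⟨div_le_exp_of_log_window hmx hMx h1 g1, div_le_exp_of_log_window hmy hMy h2 g2⟩,
        div_le_exp_of_log_window hmz hMz h3 g3⟩, div_le_exp_of_log_window hmIn hMIn h4 g4⟩,
        div_le_exp_of_log_window hmOut hMOut h5 g5⟩
  rw [hratio.csInf_eq, hprog.csInf_eq, Real.exp_log hKpos]
end

section
/- Makhoul's algorithm computes the DCT from the DFT: let N ≥ 1 and v ∈ ℝ^N. Define w ∈ ℝ^N by w_i = v_{2i} for 0 ≤ i ≤ ⌊(N−1)/2⌋ and w_i = v_{2N−2i−1} for ⌊(N+1)/2⌋ ≤ i ≤ N−1, and let ŵ_k = Σ_{i=0}^{N−1} w_i exp(−2πI·ik/N) ∈ ℂ be the discrete Fourier transform of w (I the imaginary unit). Then for every 0 ≤ k ≤ N−1, the forward DCT of v satisfies v̂_k = Σ_{i=0}^{N−1} v_i cos(π(2i+1)k/(2N)) = Re(exp(−Iπk/(2N)) · ŵ_k). -/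
open Complex

/-- The index permutation underlying Makhoul's algorithm: even indices in increasing order,
followed by odd indices in decreasing order. -/
theorem sum_range_makhoul_reindex {M : Type*} [AddCommMonoid M] (N : ℕ) (f : ℕ → M) :
    ∑ i ∈ Finset.range N, f (if 2 * i < N then 2 * i else 2 * N - 2 * i - 1)
      = ∑ j ∈ Finset.range N, f j := by
  refine Finset.sum_nbij' (fun i => if 2 * i < N then 2 * i else 2 * N - 2 * i - 1)
    (fun j => if j % 2 = 0 then j / 2 else (2 * N - 1 - j) / 2) ?_ ?_ ?_ ?_ (fun _ _ => rfl)
  all_goals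
    intro i hi
    simp only [Finset.mem_range] at hi ⊢
    split_ifs <;> omega

theorem cos_makhoul_reindex {N i : ℕ} (hi : i < N) (k : ℕ) :
    Real.cos (Real.pi * (2 * ((if 2 * i < N then 2 * i else 2 * N - 2 * i - 1 : ℕ) : ℝ) + 1) * k
        / (2 * N))
      = Real.cos (Real.pi * (4 * i + 1) * k / (2 * N)) := by
  have hN : (N : ℝ) ≠ 0 := by
    have : N ≠ 0 := by omega
    exact_mod_cast this
  split_ifs with h
  · push_cast
    ring_nf
  · have hcast : ((2 * N - 2 * i - 1 : ℕ) : ℝ) = 2 * N - 2 * i - 1 := by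
      rw [Nat.sub_sub, Nat.cast_sub (by omega)]
      push_cast
      ring
    rw [hcast, ← Real.cos_nat_mul_two_pi_sub _ k]
    congr 1
    field_simp
    ring

theorem re_exp_mul_ofReal_mul_exp (N i k : ℕ) (x : ℝ) :
    (Complex.exp (-(Complex.I * (Real.pi : ℂ) * (k : ℂ) / (2 * (N : ℂ)))) *
        ((x : ℂ) *
          Complex.exp (-(2 * (Real.pi : ℂ) * Complex.I * (i : ℂ) * (k : ℂ) / (N : ℂ))))).re
      = x * Real.cos (Real.pi * (4 * i + 1) * k / (2 * N)) := by
  rw [mul_left_comm, ← Complex.exp_add, Complex.re_ofReal_mul]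
  have harg : -(Complex.I * (Real.pi : ℂ) * (k : ℂ) / (2 * (N : ℂ))) +
      -(2 * (Real.pi : ℂ) * Complex.I * (i : ℂ) * (k : ℂ) / (N : ℂ))
      = ((-(Real.pi * (4 * i + 1) * k / (2 * N)) : ℝ) : ℂ) * Complex.I := by
    push_cast
    ring
  rw [harg, Complex.exp_ofReal_mul_I_re, Real.cos_neg]

theorem stmt_17 (N : ℕ) (hN : 1 ≤ N) (v w : ℕ → ℝ)
    (hw : ∀ i, i < N →
      w i = if 2 * i < N then v (2 * i) else v (2 * N - 2 * i - 1))
    (k : ℕ) (hk : k ≤ N - 1) :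
    ∑ i ∈ Finset.range N, v i * Real.cos (Real.pi * (2 * i + 1) * k / (2 * N))
      = (Complex.exp (-(Complex.I * (Real.pi : ℂ) * (k : ℂ) / (2 * (N : ℂ)))) *
          ∑ i ∈ Finset.range N, (w i : ℂ) *
            Complex.exp (-(2 * (Real.pi : ℂ) * Complex.I * (i : ℂ) * (k : ℂ) / (N : ℂ)))).re := by
  rw [Finset.mul_sum, Complex.re_sum, ← sum_range_makhoul_reindex]
  refine Finset.sum_congr rfl fun i hi => ?_
  have hi' := Finset.mem_range.mp hi
  rw [re_exp_mul_ofReal_mul_exp, cos_makhoul_reindex hi', hw i hi', apply_ite v]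
end
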